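/- arXiv:1412.8495 — 5 statements merged into one kernel-verified Lean document; each statement's English description precedes it below -/
import Mathlib

section
/- Let ℙ be a probability measure on (Ω, ℱ⁰_T), let τ : Ω → [0,T] be a stopping time of the right-continuous filtration (ℱ⁰_{t+})_{t∈[0,T]}, and let {ℙ_ω}_{ω∈Ω} be a conditional probability distribution of ℙ given ℱ⁰_{τ+}, i.e., a family of probability measures on (Ω, ℱ⁰_T) such that (i) for every A ∈ ℱ⁰_T the map ω ↦ ℙ_ω(A) is ℱ⁰_{τ+}-measurable, and (ii) ℙ(A ∩ B) = ∫_B ℙ_ω(A) ℙ(dω) for all A ∈ ℱ⁰_T and B ∈ ℱ⁰_{τ+}. Then for ℙ-almost every ω ∈ Ω one has ℙ_ω({ω̃ ∈ Ω : ω̃_{t∧τ(ω)} = ω_{t∧τ(ω)} for all t ∈ [0,T]}) = 1. -/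
open MeasureTheory Filter Set Topology

noncomputable section

/-- A path `ω : ℝ → ℝ^d` is càdlàg on `[0,T]`: right-continuous on `[0,T)`
and with left limits on `(0,T]`. -/
def Cadlag {E : Type*} [TopologicalSpace E] (T : ℝ) (ω : ℝ → E) : Prop :=
  (∀ t ∈ Set.Ico (0:ℝ) T, ContinuousWithinAt ω (Set.Ici t) t) ∧
  (∀ t ∈ Set.Ioc (0:ℝ) T, ∃ L, Filter.Tendsto ω (nhdsWithin t (Set.Iio t)) (nhds L))

/-- The canonical path space `Ω = D([0,T],ℝ^d)`. -/
def PathSpace (T : ℝ) (d : ℕ) := {ω : ℝ → (Fin d → ℝ) // Cadlag T ω}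

/-- The raw filtration `ℱ⁰_t = σ(X_s : 0 ≤ s ≤ t)` generated by the canonical process. -/
def F0 (T : ℝ) (d : ℕ) (t : ℝ) : MeasurableSpace (PathSpace T d) :=
  ⨆ s ∈ Set.Icc (0:ℝ) t, MeasurableSpace.comap (fun ω : PathSpace T d => ω.1 s) inferInstance

/-- The right limit `ℱ⁰_{t+} = ⋂_{s > t} ℱ⁰_s` (with `ℱ⁰_{T+} = ℱ⁰_T`). -/
def F0plus (T : ℝ) (d : ℕ) (t : ℝ) : MeasurableSpace (PathSpace T d) :=
  if t < T then ⨅ s ∈ Set.Ioc t T, F0 T d s else F0 T d T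

/-- The σ-algebra `ℱ⁰_{τ+} = {A ∈ ℱ⁰_T : A ∩ {τ ≤ t} ∈ ℱ⁰_{t+} for all t ∈ [0,T]}`. -/
def FtauPlus (T : ℝ) (d : ℕ) (τ : PathSpace T d → ℝ) : MeasurableSpace (PathSpace T d) :=
  MeasurableSpace.generateFrom
    {A | MeasurableSet[F0 T d T] A ∧
      ∀ t ∈ Set.Icc (0:ℝ) T, MeasurableSet[F0plus T d t] (A ∩ {ω | τ ω ≤ t})}

theorem F0_mono (T : ℝ) (d : ℕ) : Monotone (F0 T d) := fun _ _ h =>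
  iSup₂_le fun r hr => le_iSup₂_of_le (f := fun r (_ : r ∈ Icc 0 _) =>
    MeasurableSpace.comap (fun ω : PathSpace T d => ω.1 r) inferInstance)
    r ⟨hr.1, hr.2.trans h⟩ le_rfl

theorem measurable_eval_F0 {T : ℝ} {d : ℕ} {r s : ℝ} (hr : r ∈ Icc 0 s) :
    Measurable[F0 T d s] (fun ω : PathSpace T d => ω.1 r) :=
  measurable_iff_comap_le.2 <| le_iSup₂_of_le (f := fun r (_ : r ∈ Icc 0 s) =>
    MeasurableSpace.comap (fun ω : PathSpace T d => ω.1 r) inferInstance) r hr le_rfl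

theorem F0plus_le_F0 {T : ℝ} {d : ℕ} {t s : ℝ} (hts : t < s) (hs : s ≤ T) :
    F0plus T d t ≤ F0 T d s := by
  rw [F0plus, if_pos (hts.trans_le hs)]
  exact iInf₂_le (f := fun s (_ : s ∈ Ioc t T) => F0 T d s) s ⟨hts, hs⟩

theorem FtauPlus_le_F0 (T : ℝ) (d : ℕ) (τ : PathSpace T d → ℝ) :
    FtauPlus T d τ ≤ F0 T d T :=
  MeasurableSpace.generateFrom_le fun _ h => h.1

/-- Measurability for `ℱ⁰_{t+}` can be tested at `s ∈ (t, T]`, or at `s = T` if `t = T`. -/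
theorem measurableSet_F0plus {T : ℝ} {d : ℕ} {t : ℝ} {A : Set (PathSpace T d)} (ht : t ≤ T)
    (h : ∀ s, t ≤ s → s ≤ T → (t < s ∨ t = T) → MeasurableSet[F0 T d s] A) :
    MeasurableSet[F0plus T d t] A := by
  rcases ht.lt_or_eq with htT | htT
  · have heq : F0plus T d t = ⨅ s ∈ Ioc t T, F0 T d s := if_pos htT
    rw [heq]
    refine MeasurableSpace.measurableSet_iInf.2 fun s => MeasurableSpace.measurableSet_iInf.2 ?_
    exact fun hs => h s hs.1.le hs.2 (Or.inl hs.1)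
  · have heq : F0plus T d t = F0 T d T := if_neg htT.not_lt
    rw [heq]
    exact h T ht le_rfl (Or.inr htT)

/-- The raw filtration turns evaluation of càdlàg paths at an `ℱ⁰_s`-measurable time in `[0,s]`
into an `ℱ⁰_s`-measurable map. -/
theorem measurable_eval_random_time {T : ℝ} {d : ℕ} {s : ℝ} (hs : s ≤ T)
    {σ : PathSpace T d → ℝ} (hσ : Measurable[F0 T d s] σ) (hmem : ∀ ω, σ ω ∈ Icc 0 s) :
    Measurable[F0 T d s] (fun ω : PathSpace T d => ω.1 (σ ω)) := by
  let _ : MeasurableSpace (PathSpace T d) := F0 T d s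
  let σn : ℕ → PathSpace T d → ℝ := fun n ω =>
    min s (((⌊((n : ℝ) + 1) * σ ω⌋₊ : ℝ) + 1) / ((n : ℝ) + 1))
  have hlower : ∀ n ω, σ ω ≤ σn n ω := fun n ω => by
    refine le_min (hmem ω).2 ?_
    rw [le_div_iff₀ (by positivity), mul_comm]
    exact (Nat.lt_floor_add_one _).le
  have hupper : ∀ n ω, σn n ω ≤ σ ω + 1 / ((n : ℝ) + 1) := fun n ω => by
    have h0 : (0 : ℝ) < (n : ℝ) + 1 := by positivity
    have hfl := Nat.floor_le (mul_nonneg h0.le (hmem ω).1)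
    refine (min_le_right _ _).trans ?_
    rw [add_div]
    gcongr
    rwa [div_le_iff₀ h0, mul_comm (σ ω)]
  have hlim : ∀ ω, Tendsto (fun n => σn n ω) atTop (𝓝 (σ ω)) := fun ω => by
    refine tendsto_of_tendsto_of_tendsto_of_le_of_le tendsto_const_nhds ?_
      (fun n => hlower n ω) (fun n => hupper n ω)
    simpa using tendsto_const_nhds.add (tendsto_one_div_add_atTop_nhds_zero_nat (𝕜 := ℝ))
  refine measurable_of_tendsto_metrizable (f := fun n (ω : PathSpace T d) => ω.1 (σn n ω)) ?_ ?_
  · intro n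
    have hjoint : Measurable fun p : ℕ × PathSpace T d =>
        p.2.1 (min s (((p.1 : ℝ) + 1) / ((n : ℝ) + 1))) := by
      refine measurable_from_prod_countable_right fun k => ?_
      rcases isEmpty_or_nonempty (PathSpace T d) with hE | ⟨⟨ω⟩⟩
      · exact measurable_of_empty _
      · exact measurable_eval_F0
          ⟨le_min ((hmem ω).1.trans (hmem ω).2) <|
            show (0 : ℝ) ≤ ((k : ℝ) + 1) / ((n : ℝ) + 1) by positivity, min_le_left _ _⟩
    exact hjoint.comp ((Nat.measurable_floor.comp (hσ.const_mul _)).prodMk measurable_id)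
  · refine tendsto_pi_nhds.2 fun ω => ?_
    rcases (hmem ω).2.eq_or_lt with h | h
    · have : ∀ n, σn n ω = σ ω := fun n =>
        le_antisymm ((min_le_left _ _).trans h.ge) (hlower n ω)
      simp only [this]
      exact tendsto_const_nhds
    · exact (ω.2.1 (σ ω) ⟨(hmem ω).1, h.trans_le hs⟩).tendsto.comp
        (tendsto_nhdsWithin_iff.2 ⟨hlim ω, Eventually.of_forall fun n => hlower n ω⟩)

theorem measurable_min_stoppingTime {T : ℝ} {d : ℕ} {τ : PathSpace T d → ℝ}
    (hτmem : ∀ ω, τ ω ∈ Icc (0 : ℝ) T)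
    (hτ : ∀ t ∈ Icc (0 : ℝ) T, MeasurableSet[F0plus T d t] {ω | τ ω ≤ t})
    {t s : ℝ} (hts : t ≤ s) (hs : s ≤ T) :
    Measurable[F0 T d s] (fun ω => min (τ ω) t) := by
  let _ : MeasurableSpace (PathSpace T d) := F0 T d s
  refine measurable_of_Iic fun u => ?_
  rcases le_or_gt t u with htu | hut
  · convert MeasurableSet.univ
    exact eq_univ_of_forall fun ω => (min_le_right _ _).trans htu
  rcases lt_or_ge u 0 with hu | hu
  · convert MeasurableSet.empty
    refine eq_empty_of_forall_notMem fun ω hω => ?_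
    rcases min_le_iff.1 (show min (τ ω) t ≤ u from hω) with h | h
    · exact absurd (hτmem ω).1 (by linarith)
    · exact absurd h hut.not_ge
  · convert F0plus_le_F0 (hut.trans_le hts) hs _ (hτ u ⟨hu, (hut.le.trans hts).trans hs⟩) using 1
    ext ω
    simp [hut.not_ge]

/-- A map that agrees on each `{τ ≤ t}` with a map measurable for every relevant `ℱ⁰_s` is
`ℱ⁰_{τ+}`-measurable. -/
theorem measurable_FtauPlus {T : ℝ} {d : ℕ} {τ : PathSpace T d → ℝ} {α : Type*}
    [MeasurableSpace α] (hT : 0 ≤ T) (hτmem : ∀ ω, τ ω ∈ Icc (0 : ℝ) T)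
    (hτ : ∀ t ∈ Icc (0 : ℝ) T, MeasurableSet[F0plus T d t] {ω | τ ω ≤ t})
    {Y : PathSpace T d → α} (Z : ℝ → PathSpace T d → α)
    (hYZ : ∀ t ω, τ ω ≤ t → Y ω = Z t ω)
    (hZ : ∀ t s, 0 ≤ t → t ≤ s → s ≤ T → Measurable[F0 T d s] (Z t)) :
    Measurable[FtauPlus T d τ] Y := by
  intro C hC
  refine MeasurableSpace.measurableSet_generateFrom ⟨?_, fun t ht => ?_⟩
  · have : Y = Z T := funext fun ω => hYZ T ω (hτmem ω).2
    rw [this]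
    exact hZ T T hT le_rfl le_rfl hC
  · refine measurableSet_F0plus ht.2 fun s hts hs hor => ?_
    have hset : Y ⁻¹' C ∩ {ω | τ ω ≤ t} = Z t ⁻¹' C ∩ {ω | τ ω ≤ t} := by
      ext ω
      refine and_congr_left fun hω => ?_
      rw [mem_preimage, mem_preimage, hYZ t ω hω]
    rw [hset]
    refine MeasurableSet.inter (hZ t s ht.1 hts hs hC) ?_
    rcases hor with h | h
    · exact F0plus_le_F0 h hs _ (hτ t ht)
    · convert @MeasurableSet.univ _ (F0 T d s)
      exact eq_univ_of_forall fun ω => h ▸ (hτmem ω).2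

/-- A conditional probability distribution given `m` is concentrated on the level sets of any
`m`-measurable map with values in a countably separated space. -/
theorem ae_ae_eq_of_conditional {Ω α : Type*} {m m0 : MeasurableSpace Ω} (hm : m ≤ m0)
    [MeasurableSpace α] [MeasurableSpace.CountablySeparated α]
    {P : @Measure Ω m0} {Pc : Ω → @Measure Ω m0}
    (hmeas : ∀ A : Set Ω, MeasurableSet[m0] A → Measurable[m] (fun ω => Pc ω A))
    (hdisint : ∀ A B : Set Ω, MeasurableSet[m0] A → MeasurableSet[m] B →
      P (A ∩ B) = ∫⁻ ω in B, Pc ω A ∂P)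
    {Y : Ω → α} (hY : Measurable[m] Y) :
    ∀ᵐ ω ∂P, ∀ᵐ ω' ∂(Pc ω), Y ω' = Y ω := by
  have key : ∀ C : Set α, MeasurableSet C →
      ∀ᵐ ω ∂P, Y ω ∈ C → ∀ᵐ ω' ∂(Pc ω), Y ω' ∈ C := by
    intro C hC
    have hB : MeasurableSet[m] (Y ⁻¹' C) := hY hC
    have h := hdisint (Y ⁻¹' C)ᶜ (Y ⁻¹' C) (hm _ hB).compl hB
    rw [compl_inter_self, measure_empty, eq_comm,
      lintegral_eq_zero_iff ((hmeas _ (hm _ hB).compl).mono hm le_rfl)] at h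
    filter_upwards [(ae_restrict_iff' (hm _ hB)).1 h] with ω hω hωC
    exact hω hωC
  obtain ⟨S, hS, hsep⟩ := exists_seq_separating α MeasurableSet.empty univ
  have hall := (ae_all_iff.2 fun n => key _ (hS n)).and
    (ae_all_iff.2 fun n => key _ (hS n).compl)
  filter_upwards [hall] with ω hω
  have hiff : ∀ n, ∀ᵐ ω' ∂(Pc ω), (Y ω' ∈ S n ↔ Y ω ∈ S n) := fun n => by
    by_cases h : Y ω ∈ S n
    · filter_upwards [hω.1 n h] with ω' hω'
      exact iff_of_true hω' h
    · filter_upwards [hω.2 n h] with ω' hω'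
      exact iff_of_false hω' h
  filter_upwards [ae_all_iff.2 hiff] with ω' hω'
  exact hsep _ (mem_univ _) _ (mem_univ _) hω'

/-- Two càdlàg paths that agree at `q ∧ r` for every nonnegative rational `q` agree
on `[0,r]`. -/
theorem PathSpace.stopped_eq_of_rat {T : ℝ} {d : ℕ} {ω ω' : PathSpace T d} {r : ℝ}
    (hr : r ≤ T) (h : ∀ q : ℚ, ω'.1 (min (max (q : ℝ) 0) r) = ω.1 (min (max (q : ℝ) 0) r))
    {t : ℝ} (ht : 0 ≤ t) : ω'.1 (min t r) = ω.1 (min t r) := by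
  rcases le_or_gt r t with hrt | htr
  · obtain ⟨q, hq⟩ := exists_rat_gt r
    have := h q
    rwa [min_eq_right (hq.le.trans (le_max_left _ _)), ← min_eq_right hrt] at this
  · rw [min_eq_left htr.le]
    have htT : t ∈ Ico 0 T := ⟨ht, htr.trans_le hr⟩
    refine tendsto_nhds_unique_of_frequently_eq
      ((ω'.2.1 t htT).mono Ioi_subset_Ici_self) ((ω.2.1 t htT).mono Ioi_subset_Ici_self) ?_
    refine (nhdsGT_basis t).frequently_iff.2 fun b hb => ?_
    obtain ⟨q, hq1, hq2⟩ := exists_rat_btwn (lt_min hb htr)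
    refine ⟨q, ⟨hq1, hq2.trans_le (min_le_left _ _)⟩, ?_⟩
    have := h q
    rwa [max_eq_left (ht.trans hq1.le), min_eq_left (hq2.le.trans (min_le_right _ _))] at this

/-- If `ℙ` is a probability measure on `(Ω, ℱ⁰_T)`, `τ` a stopping time of
`(ℱ⁰_{t+})`, and `{ℙ_ω}` a conditional probability distribution of `ℙ` given `ℱ⁰_{τ+}`, then for
`ℙ`-a.e. `ω` the measure `ℙ_ω` gives full mass to the paths agreeing with `ω` up to time `τ(ω)`. -/
theorem stmt0 (T : ℝ) (hT : 0 < T) (d : ℕ)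
    (P : @Measure (PathSpace T d) (F0 T d T)) (hP : @IsProbabilityMeasure _ (F0 T d T) P)
    (τ : PathSpace T d → ℝ) (hτmem : ∀ ω, τ ω ∈ Set.Icc (0:ℝ) T)
    (hτ : ∀ t ∈ Set.Icc (0:ℝ) T, MeasurableSet[F0plus T d t] {ω | τ ω ≤ t})
    (Pc : PathSpace T d → @Measure (PathSpace T d) (F0 T d T))
    (hPc : ∀ ω, @IsProbabilityMeasure _ (F0 T d T) (Pc ω))
    (hmeas : ∀ A : Set (PathSpace T d), MeasurableSet[F0 T d T] A →
      Measurable[FtauPlus T d τ] (fun ω => Pc ω A))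
    (hdisint : ∀ A B : Set (PathSpace T d), MeasurableSet[F0 T d T] A →
      MeasurableSet[FtauPlus T d τ] B → P (A ∩ B) = ∫⁻ ω in B, Pc ω A ∂P) :
    ∀ᵐ ω ∂P, Pc ω {ω' : PathSpace T d | ∀ t ∈ Set.Icc (0:ℝ) T,
      ω'.1 (min t (τ ω)) = ω.1 (min t (τ ω))} = 1 := by
  have hle := FtauPlus_le_F0 T d τ
  have hτmeas : Measurable[FtauPlus T d τ] τ :=
    measurable_FtauPlus hT.le hτmem hτ (fun t ω => min (τ ω) t)
      (fun t ω h => (min_eq_left h).symm)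
      (fun t s _ hts hs => measurable_min_stoppingTime hτmem hτ hts hs)
  have hXmeas : ∀ q : ℚ, Measurable[FtauPlus T d τ]
      (fun ω : PathSpace T d => ω.1 (min (max (q : ℝ) 0) (τ ω))) := fun q =>
    measurable_FtauPlus hT.le hτmem hτ
      (fun t ω => ω.1 (min (max (q : ℝ) 0) (min (τ ω) t)))
      (fun t ω h => by simp only [min_eq_left h])
      (fun t s ht hts hs => measurable_eval_random_time hs
        (Measurable.min measurable_const (measurable_min_stoppingTime hτmem hτ hts hs))
        fun ω => ⟨le_min (le_max_right _ _) (le_min (hτmem ω).1 ht),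
          (min_le_right _ _).trans ((min_le_right _ _).trans hts)⟩)
  filter_upwards [ae_ae_eq_of_conditional hle hmeas hdisint hτmeas,
    ae_all_iff.2 fun q => ae_ae_eq_of_conditional hle hmeas hdisint (hXmeas q)] with ω h1 h2
  have hagree : ∀ᵐ ω' ∂(Pc ω), ω' ∈ {ω' : PathSpace T d | ∀ t ∈ Set.Icc (0:ℝ) T,
      ω'.1 (min t (τ ω)) = ω.1 (min t (τ ω))} := by
    filter_upwards [h1, ae_all_iff.2 h2] with ω' hτ' hX t ht
    rw [hτ'] at hX
    exact PathSpace.stopped_eq_of_rat (hτmem ω).2 hX ht.1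
  exact (measure_congr (eventuallyEq_univ.2 hagree)).trans (hPc ω).measure_univ
end
end

section
/- Fix T>0, d∈ℕ, a càdlàg path ω ∈ D([0,T],ℝ^d), s ∈ [0,T], and ε > 0. Define h : ℝ^d → [s,T] by h(x) := inf{ t ∈ [s,T] : |ω_t − x| ≥ ε } ∧ T (with inf ∅ interpreted so that h(x) = T when the set is empty). Then h is universally measurable: for every finite Borel measure μ on ℝ^d, h is measurable with respect to the μ-completion of the Borel σ-algebra of ℝ^d (equivalently, h agrees μ-almost everywhere with a Borel measurable function). -/
open MeasureTheory Filter Set Topology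

noncomputable section

/-- The measure of an analytic set is approximated from inside by compact sets. -/
theorem MeasureTheory.AnalyticSet.exists_isCompact_subset_le_measure {X : Type*}
    [TopologicalSpace X] [MeasurableSpace X] (μ : Measure X) [μ.OuterRegular]
    {A : Set X} (hA : AnalyticSet A) {b : ENNReal} (hb : b < μ A) :
    ∃ K ⊆ A, IsCompact K ∧ b ≤ μ K := by
  rw [AnalyticSet] at hA
  obtain rfl | ⟨f, hf, rfl⟩ := hA
  · simp at hb
  have step : ∀ (k : ℕ) (S : Set (ℕ → ℕ)), ∃ m : ℕ,
      b < μ (f '' S) → b < μ (f '' (S ∩ {σ | σ k ≤ m})) := by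
    intro k S
    by_cases hS : b < μ (f '' S)
    · have hmono : Monotone fun m : ℕ => f '' (S ∩ {σ | σ k ≤ m}) := fun m m' hm =>
        image_mono (inter_subset_inter_right _ fun σ (hσ : σ k ≤ m) => hσ.trans hm)
      have hunion : ⋃ m : ℕ, f '' (S ∩ {σ | σ k ≤ m}) = f '' S := by
        rw [← image_iUnion, ← inter_iUnion]
        congr 1
        exact inter_eq_left.2 fun σ _ => mem_iUnion.2 ⟨σ k, le_refl (σ k)⟩
      rw [← hunion, hmono.measure_iUnion, lt_iSup_iff] at hS
      obtain ⟨m, hm⟩ := hS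
      exact ⟨m, fun _ => hm⟩
    · exact ⟨0, fun h => absurd h hS⟩
  choose m hm using step
  let S : ℕ → Set (ℕ → ℕ) := fun k => Nat.rec univ (fun k S => S ∩ {σ | σ k ≤ m k S}) k
  let n : ℕ → ℕ := fun k => m k (S k)
  have hSmeas : ∀ k, b < μ (f '' S k) := by
    intro k
    induction k with
    | zero => simpa [S] using hb
    | succ k ih => exact hm k _ ih
  have hSmem : ∀ k, ∀ σ ∈ S k, ∀ i < k, σ i ≤ n i := by
    intro k
    induction k with
    | zero => intro _ _ i hi; omega
    | succ k ih =>
      rintro σ ⟨hσ, hσk⟩ i hi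
      obtain hi | rfl := Nat.lt_succ_iff_lt_or_eq.1 hi
      · exact ih σ hσ i hi
      · exact hσk
  have hP : IsCompact (Set.pi univ fun i => Set.Iic (n i)) :=
    isCompact_univ_pi fun i => (Set.finite_Iic (n i)).isCompact
  refine ⟨f '' Set.pi univ fun i => Set.Iic (n i), image_subset_range _ _, hP.image hf, ?_⟩
  by_contra! hlt
  obtain ⟨U, hKU, hU, hUb⟩ := Set.exists_isOpen_lt_of_lt _ _ hlt
  have hout : ∀ k, ∃ σ ∈ S k, f σ ∉ U := by
    intro k
    by_contra! h
    exact ((hSmeas k).trans_le (measure_mono (image_subset_iff.2 h))).not_gt hUb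
  choose σ hσS hσU using hout
  obtain ⟨p, hp, φ, hφ, hlim⟩ := hP.tendsto_subseq (x := fun k i => min (σ k i) (n i))
    fun k i _ => Set.mem_Iic.2 (min_le_right _ _)
  have hlim' : Tendsto (σ ∘ φ) atTop (𝓝 p) := by
    rw [tendsto_pi_nhds] at hlim ⊢
    intro i
    refine (hlim i).congr' ?_
    filter_upwards [eventually_gt_atTop i] with j hj
    exact min_eq_left (hSmem _ _ (hσS (φ j)) i (hj.trans_le (hφ.id_le j)))
  exact (hU.isClosed_compl.preimage hf).mem_of_tendsto hlim'
    (Eventually.of_forall fun j => hσU (φ j)) (hKU (mem_image_of_mem f hp))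

/-- Analytic sets are universally measurable. -/
theorem MeasureTheory.AnalyticSet.nullMeasurableSet {X : Type*}
    [TopologicalSpace X] [T2Space X] [MeasurableSpace X] [OpensMeasurableSpace X]
    (μ : Measure X) [IsFiniteMeasure μ] [μ.OuterRegular]
    {A : Set X} (hA : AnalyticSet A) : NullMeasurableSet A μ := by
  obtain h0 | h0 := eq_or_ne (μ A) 0
  · exact NullMeasurableSet.of_null h0
  obtain ⟨u, -, hu, hlim⟩ := exists_seq_strictMono_tendsto' (pos_iff_ne_zero.2 h0)
  choose K hKA hK hKu using fun k =>
    hA.exists_isCompact_subset_le_measure μ (hu k).2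
  have hmeas : MeasurableSet (⋃ k, K k) := .iUnion fun k => (hK k).measurableSet
  have hle : μ A ≤ μ (⋃ k, K k) :=
    le_of_tendsto' hlim fun k => (hKu k).trans (measure_mono (subset_iUnion K k))
  exact hmeas.nullMeasurableSet.congr (ae_eq_of_subset_of_measure_ge (iUnion_subset hKA) hle
    hmeas.nullMeasurableSet (measure_ne_top μ A))

/-- A right-continuous function on the real line is Borel measurable. -/
theorem measurable_of_continuousWithinAt_Ici {E : Type*} [TopologicalSpace E]
    [TopologicalSpace.PseudoMetrizableSpace E] [MeasurableSpace E] [BorelSpace E]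
    {g : ℝ → E} (hg : ∀ t, ContinuousWithinAt g (Set.Ici t) t) : Measurable g := by
  let r : ℕ → ℝ → ℝ := fun n t => ((⌊((n : ℝ) + 1) * t⌋ : ℝ) + 1) / ((n : ℝ) + 1)
  have hr : ∀ n t, t ≤ r n t ∧ r n t ≤ t + 1 / ((n : ℝ) + 1) := by
    intro n t
    have hn : (0 : ℝ) < (n : ℝ) + 1 := by positivity
    constructor
    · rw [le_div_iff₀ hn]
      linarith [Int.lt_floor_add_one (((n : ℝ) + 1) * t)]
    · rw [div_le_iff₀ hn, add_mul t, one_div_mul_cancel hn.ne']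
      linarith [Int.floor_le (((n : ℝ) + 1) * t)]
  refine measurable_of_tendsto_metrizable (f := fun n t => g (r n t)) (fun n => ?_) ?_
  · exact (measurable_from_top (f := fun k : ℤ => g (((k : ℝ) + 1) / ((n : ℝ) + 1)))).comp
      (Int.measurable_floor.comp (measurable_const_mul ((n : ℝ) + 1)))
  · rw [tendsto_pi_nhds]
    intro t
    refine (hg t).tendsto.comp (tendsto_nhdsWithin_iff.2
      ⟨?_, Eventually.of_forall fun n => (hr n t).1⟩)
    refine tendsto_of_tendsto_of_tendsto_of_le_of_le tendsto_const_nhds ?_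
      (fun n => (hr n t).1) (fun n => (hr n t).2)
    simpa using tendsto_one_div_add_atTop_nhds_zero_nat.const_add t

/-- A càdlàg path, extended by zero outside `[0,T)`, is Borel measurable. -/
theorem Cadlag.measurable_indicator {E : Type*} [TopologicalSpace E]
    [TopologicalSpace.PseudoMetrizableSpace E] [MeasurableSpace E] [BorelSpace E] [Zero E]
    {T : ℝ} {ω : ℝ → E} (hω : Cadlag T ω) : Measurable ((Set.Ico 0 T).indicator ω) := by
  refine measurable_of_continuousWithinAt_Ici fun t => ?_
  by_cases ht : t ∈ Set.Ico 0 T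
  · refine (hω.1 t ht).congr_of_eventuallyEq ?_ (indicator_of_mem ht _)
    filter_upwards [self_mem_nhdsWithin, mem_nhdsWithin_of_mem_nhds (Iio_mem_nhds ht.2)]
      with u hu hu'
    exact indicator_of_mem (show u ∈ Set.Ico 0 T from ⟨ht.1.trans hu, hu'⟩) _
  · refine (continuousWithinAt_const (b := (0 : E))).congr_of_eventuallyEq ?_
      (indicator_of_notMem ht _)
    obtain ht0 | ht0 := lt_or_ge t 0
    · filter_upwards [mem_nhdsWithin_of_mem_nhds (Iio_mem_nhds ht0)] with u hu
      exact indicator_of_notMem (fun h => h.1.not_gt hu) _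
    · filter_upwards [self_mem_nhdsWithin] with u hu
      exact indicator_of_notMem (fun h => ht ⟨ht0, (mem_Ici.1 hu).trans_lt h.2⟩) _

/-- The set of points from which a càdlàg path is at distance at least `ε` at some time
in `[s,c)` is analytic. -/
theorem Cadlag.analyticSet_exists_le_norm_sub {E : Type*} [NormedAddCommGroup E]
    [CompleteSpace E] [SecondCountableTopology E] [MeasurableSpace E] [BorelSpace E]
    {T : ℝ} {ω : ℝ → E} (hω : Cadlag T ω) {s c : ℝ} (hs : 0 ≤ s) (hc : c ≤ T) (ε : ℝ) :
    AnalyticSet {x : E | ∃ t ∈ Set.Ico s c, ε ≤ ‖ω t - x‖} := by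
  have hmeas : MeasurableSet {z : ℝ × E |
      z.1 ∈ Set.Ico s c ∧ ε ≤ ‖(Set.Ico 0 T).indicator ω z.1 - z.2‖} :=
    (measurable_fst measurableSet_Ico).inter (measurableSet_le measurable_const
      ((hω.measurable_indicator.comp measurable_fst).sub measurable_snd).norm)
  convert hmeas.analyticSet_image measurable_snd using 1
  have hind : ∀ t ∈ Set.Ico s c, (Set.Ico 0 T).indicator ω t = ω t := fun t ht =>
    indicator_of_mem (show t ∈ Set.Ico 0 T from ⟨hs.trans ht.1, ht.2.trans_le hc⟩) _
  ext x
  constructor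
  · rintro ⟨t, ht, hx⟩
    exact ⟨(t, x), ⟨ht, by rwa [hind t ht]⟩, rfl⟩
  · rintro ⟨⟨t, y⟩, ⟨ht, hy⟩, rfl⟩
    exact ⟨t, ht, by rwa [hind t ht] at hy⟩

/-- For a càdlàg path `ω ∈ D([0,T],ℝ^d)`, `s ∈ [0,T]` and `ε > 0`, the map
`h(x) = inf{t ∈ [s,T] : |ω_t − x| ≥ ε} ∧ T` (equal to `T` when the set is empty) is universally
measurable: for every finite Borel measure `μ` on `ℝ^d` it agrees `μ`-a.e. with a Borel map. -/
theorem stmt2 (T : ℝ) (hT : 0 < T) (d : ℕ)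
    (ω : ℝ → EuclideanSpace ℝ (Fin d)) (hω : Cadlag T ω)
    (s : ℝ) (hs : s ∈ Set.Icc (0:ℝ) T) (ε : ℝ) (hε : 0 < ε) :
    ∀ μ : Measure (EuclideanSpace ℝ (Fin d)), IsFiniteMeasure μ →
      AEMeasurable
        (fun x : EuclideanSpace ℝ (Fin d) =>
          sInf ({t ∈ Set.Icc s T | ε ≤ ‖ω t - x‖} ∪ {T})) μ := by
  intro μ hμ
  refine NullMeasurable.aemeasurable ?_
  refine measurable_of_Iio (α := ℝ) (δ := NullMeasurableSpace _ μ) fun c => ?_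
  change NullMeasurableSet _ μ
  have hbdd : ∀ x, BddBelow ({t ∈ Set.Icc s T | ε ≤ ‖ω t - x‖} ∪ {T}) := fun x =>
    ⟨s, by rintro t (ht | rfl); exacts [ht.1.1, hs.2]⟩
  obtain hc | hc := le_or_gt c T
  · refine (congrArg (NullMeasurableSet · μ) (Set.ext fun x => ?_)).mpr
      ((hω.analyticSet_exists_le_norm_sub hs.1 hc ε).nullMeasurableSet μ)
    refine (csInf_lt_iff (hbdd x) ⟨T, Or.inr rfl⟩).trans ⟨?_, ?_⟩
    · rintro ⟨t, ht | rfl, htc⟩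
      exacts [⟨t, ⟨ht.1.1, htc⟩, ht.2⟩, absurd htc hc.not_gt]
    · rintro ⟨t, ht, hx⟩
      exact ⟨t, Or.inl ⟨⟨ht.1, ht.2.le.trans hc⟩, hx⟩, ht.2⟩
  · refine (congrArg (NullMeasurableSet · μ) (eq_univ_of_forall fun x => ?_)).mpr
      nullMeasurableSet_univ
    exact (csInf_le (hbdd x) (Or.inr rfl)).trans_lt hc
end
end

section
/- Fix T>0, a càdlàg path ω ∈ D([0,T],ℝ), s ∈ [0,T], and ε > 0. Then the map ℝ → [s,T], x ↦ inf{ t ∈ [s,T] : |ω_t − x| ≥ ε } ∧ T (with the infimum over the empty set interpreted so that the value is T when the set is empty), is Borel measurable. -/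
open MeasureTheory Filter Set Topology

noncomputable section

/-- For a càdlàg path `ω ∈ D([0,T],ℝ)`, `s ∈ [0,T]` and `ε > 0`, the map
`x ↦ inf{t ∈ [s,T] : |ω_t − x| ≥ ε} ∧ T` (equal to `T` when the set is empty) is
Borel measurable. -/
theorem stmt3 (T : ℝ) (hT : 0 < T)
    (ω : ℝ → ℝ) (hω : Cadlag T ω)
    (s : ℝ) (hs : s ∈ Set.Icc (0:ℝ) T) (ε : ℝ) (hε : 0 < ε) :
    Measurable (fun x : ℝ => sInf ({t ∈ Set.Icc s T | ε ≤ |ω t - x|} ∪ {T})) := by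
  refine measurable_of_Iio fun a => ?_
  have h_eq : (fun x : ℝ => sInf ({t ∈ Set.Icc s T | ε ≤ |ω t - x|} ∪ {T})) ⁻¹' Set.Iio a =
      ({x | ∃ t ∈ Set.Icc s T, t < a ∧ x ≤ ω t - ε} ∪
        {x | ∃ t ∈ Set.Icc s T, t < a ∧ ω t + ε ≤ x}) ∪ {_x | T < a} := by
    ext x
    have h_bdd : BddBelow ({t ∈ Set.Icc s T | ε ≤ |ω t - x|} ∪ {T}) := by
      refine ⟨s, ?_⟩
      rintro t (ht | rfl)
      exacts [ht.1.1, hs.2]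
    rw [Set.mem_preimage, Set.mem_Iio, csInf_lt_iff h_bdd ⟨T, Or.inr rfl⟩]
    constructor
    · rintro ⟨t, ⟨ht, h⟩ | rfl, hta⟩
      · rcases le_abs.1 h with h | h
        · exact Or.inl (Or.inl ⟨t, ht, hta, by linarith⟩)
        · exact Or.inl (Or.inr ⟨t, ht, hta, by linarith⟩)
      · exact Or.inr hta
    · rintro ((⟨t, ht, hta, h⟩ | ⟨t, ht, hta, h⟩) | h)
      · exact ⟨t, Or.inl ⟨ht, le_abs.2 (Or.inl (by linarith))⟩, hta⟩
      · exact ⟨t, Or.inl ⟨ht, le_abs.2 (Or.inr (by linarith))⟩, hta⟩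
      · exact ⟨T, Or.inr rfl, h⟩
  have h_lower : IsLowerSet {x | ∃ t ∈ Set.Icc s T, t < a ∧ x ≤ ω t - ε} :=
    fun _ _ hyx ⟨t, ht, hta, h⟩ => ⟨t, ht, hta, hyx.trans h⟩
  have h_upper : IsUpperSet {x | ∃ t ∈ Set.Icc s T, t < a ∧ ω t + ε ≤ x} :=
    fun _ _ hxy ⟨t, ht, hta, h⟩ => ⟨t, ht, hta, h.trans hxy⟩
  rw [h_eq]
  exact (h_lower.ordConnected.measurableSet.union h_upper.ordConnected.measurableSet).union
    (MeasurableSet.const _)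
end
end

section
/- Let u : Λ̄ → ℝ be continuous with respect to the pseudometric d_∞. Fix t ∈ (0,T] and ω ∈ D([0,T],ℝ^d), and suppose that u has a jump at t along ω, in the sense that limsup_{s↑t} |u(t,ω) − u(s,ω)| > 0. Then the path ω itself jumps at t: ω_{t−} ≠ ω_t. -/
open MeasureTheory Filter Set Topology

noncomputable section

/-- The pseudometric `d_∞((t,ω),(t',ω')) = |t−t'| + sup_{0≤s≤T} ‖ω_{s∧t} − ω'_{s∧t'}‖`
on `Λ̄ = [0,T] × D([0,T],E)`. -/
def dInfty {E : Type*} [NormedAddCommGroup E] (T : ℝ) (p q : ℝ × (ℝ → E)) : ℝ :=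
  |p.1 - q.1| + ⨆ s : Set.Icc (0:ℝ) T, ‖p.2 (min s p.1) - q.2 (min s q.1)‖

/-- Continuity of a functional `u : Λ̄ → ℝ` with respect to the pseudometric `d_∞`. -/
def DCont {E : Type*} [NormedAddCommGroup E] (T : ℝ) (u : ℝ → (ℝ → E) → ℝ) : Prop :=
  ∀ t ∈ Set.Icc (0:ℝ) T, ∀ ω : ℝ → E, Cadlag T ω → ∀ ε > (0:ℝ), ∃ δ > (0:ℝ),
    ∀ t' ∈ Set.Icc (0:ℝ) T, ∀ ω' : ℝ → E, Cadlag T ω' →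
      dInfty T (t, ω) (t', ω') < δ → |u t ω - u t' ω'| < ε

/-- If `ω` is left-continuous at `t > 0`, then `(s, ω)` tends to `(t, ω)` in `d_∞` as `s ↑ t`. -/
theorem eventually_dInfty_lt {E : Type*} [NormedAddCommGroup E] {T t : ℝ} (hT : 0 ≤ T)
    {ω : ℝ → E} (h : Tendsto ω (𝓝[<] t) (𝓝 (ω t))) {δ : ℝ} (hδ : 0 < δ) :
    ∀ᶠ s in 𝓝[<] t, dInfty T (t, ω) (s, ω) < δ := by
  have hball : ∀ᶠ r in 𝓝[<] t, dist (ω r) (ω t) < δ / 4 :=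
    h.eventually (Metric.ball_mem_nhds _ (by positivity))
  obtain ⟨a, ha, hsub⟩ := mem_nhdsLT_iff_exists_Ioo_subset.mp hball
  have hclose : ∀ r, a < r → r ≤ t → dist (ω r) (ω t) < δ / 4 := by
    intro r har hrt
    rcases hrt.eq_or_lt with rfl | hlt
    · simpa using hδ
    · exact hsub ⟨har, hlt⟩
  filter_upwards [Ioo_mem_nhdsLT (mem_Iio.mp ha), Ioo_mem_nhdsLT (show t - δ / 4 < t by linarith)]
    with s hs hs'
  have : Nonempty (Icc (0 : ℝ) T) := ⟨⟨0, le_rfl, hT⟩⟩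
  have hsup : ⨆ r : Icc (0 : ℝ) T, ‖ω (min r t) - ω (min r s)‖ ≤ δ / 2 := by
    refine ciSup_le fun r => ?_
    rcases le_total (r : ℝ) s with hrs | hsr
    · rw [min_eq_left hrs, min_eq_left (hrs.trans hs.2.le), sub_self, norm_zero]
      positivity
    · rw [min_eq_right hsr, ← dist_eq_norm]
      have h₁ := hclose (min r t) (lt_min (hs.1.trans_le hsr) (hs.1.trans hs.2)) (min_le_right _ _)
      have h₂ := hclose s hs.1 hs.2.le
      linarith [dist_triangle_right (ω (min r t)) (ω s) (ω t)]
  have htime : |t - s| < δ / 4 := by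
    rw [abs_of_pos (sub_pos.mpr hs.2)]
    linarith [hs'.1]
  unfold dInfty
  dsimp only
  linarith

/-- If `u : Λ̄ → ℝ` is `d_∞`-continuous and `u` jumps at `t ∈ (0,T]` along a
càdlàg path `ω` (i.e. `limsup_{s↑t} |u(t,ω) − u(s,ω)| > 0`), then the path `ω` itself jumps
at `t`: its left limit at `t` differs from `ω_t`. -/
theorem stmt8 (T : ℝ) (hT : 0 < T) (d : ℕ)
    (u : ℝ → (ℝ → EuclideanSpace ℝ (Fin d)) → ℝ) (hu : DCont T u)
    (t : ℝ) (ht : t ∈ Set.Ioc (0:ℝ) T)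
    (ω : ℝ → EuclideanSpace ℝ (Fin d)) (hω : Cadlag T ω)
    (hjump : ∃ c > (0:ℝ), ∃ᶠ s in nhdsWithin t (Set.Iio t), c ≤ |u t ω - u s ω|) :
    ∃ L, Filter.Tendsto ω (nhdsWithin t (Set.Iio t)) (nhds L) ∧ L ≠ ω t := by
  obtain ⟨L, hL⟩ := hω.2 t ht
  refine ⟨L, hL, ?_⟩
  rintro rfl
  obtain ⟨c, hc, hfreq⟩ := hjump
  obtain ⟨δ, hδ, hcont⟩ := hu t ⟨ht.1.le, ht.2⟩ ω hω c hc
  obtain ⟨s, hs, hd, hs₀⟩ := (hfreq.and_eventually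
    ((eventually_dInfty_lt hT.le hL hδ).and (Ioo_mem_nhdsLT ht.1))).exists
  exact (hcont s ⟨hs₀.1.le, hs₀.2.le.trans ht.2⟩ ω hω hd).not_ge hs
end
end

section
/- Let u : Λ̄ → ℝ be continuous with respect to the pseudometric d_∞. Then: (i) u is non-anticipating, i.e. u(t,ω) = u(t, ω_{·∧t}) for every (t,ω) ∈ Λ̄; and (ii) for every ω ∈ D([0,T],ℝ^d) and every t ∈ (0,T], the left limit lim_{s↑t} u(s,ω) exists and equals u(t, ω_{·∧t−}), where ω_{·∧t−} denotes the path equal to ω on [0,t) and constantly equal to ω_{t−} on [t,T]. -/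
open MeasureTheory Filter Set Topology

noncomputable section

/-- Stopping a càdlàg path at `t` gives a càdlàg path. -/
theorem Cadlag.comp_min {E : Type*} [TopologicalSpace E] {T : ℝ} {ω : ℝ → E}
    (hω : Cadlag T ω) (t : ℝ) : Cadlag T (fun s => ω (min s t)) := by
  refine ⟨fun s hs => ?_, fun s hs => ?_⟩
  · rcases lt_or_ge s t with h | h
    · refine (hω.1 s hs).congr_of_eventuallyEq ?_ (by simp [h.le])
      filter_upwards [mem_nhdsWithin_of_mem_nhds (Iio_mem_nhds h)] with r hr
      simp [(mem_Iio.1 hr).le]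
    · refine continuousWithinAt_const (b := ω t) |>.congr (fun r hr => ?_) (by simp [h])
      simp [h.trans (mem_Ici.1 hr)]
  · rcases le_or_gt s t with h | h
    · obtain ⟨L, hL⟩ := hω.2 s hs
      refine ⟨L, hL.congr' ?_⟩
      filter_upwards [self_mem_nhdsWithin] with r hr
      simp [(mem_Iio.1 hr).le.trans h]
    · refine ⟨ω t, tendsto_const_nhds.congr' ?_⟩
      filter_upwards [mem_nhdsWithin_of_mem_nhds (Ioi_mem_nhds h)] with r hr
      simp [(mem_Ioi.1 hr).le]

/-- Freezing a càdlàg path at a left limit gives a càdlàg path. -/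
theorem Cadlag.ite_lt {E : Type*} [TopologicalSpace E] {T : ℝ} {ω : ℝ → E}
    (hω : Cadlag T ω) (t : ℝ) (L : E) : Cadlag T (fun s => if s < t then ω s else L) := by
  refine ⟨fun s hs => ?_, fun s hs => ?_⟩
  · rcases lt_or_ge s t with h | h
    · refine (hω.1 s hs).congr_of_eventuallyEq ?_ (by simp [h])
      filter_upwards [mem_nhdsWithin_of_mem_nhds (Iio_mem_nhds h)] with r hr
      simp [mem_Iio.1 hr]
    · refine continuousWithinAt_const (b := L) |>.congr (fun r hr => ?_) (by simp [h.not_gt])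
      simp [(h.trans (mem_Ici.1 hr)).not_gt]
  · rcases le_or_gt s t with h | h
    · obtain ⟨M, hM⟩ := hω.2 s hs
      refine ⟨M, hM.congr' ?_⟩
      filter_upwards [self_mem_nhdsWithin] with r hr
      simp [(mem_Iio.1 hr).trans_le h]
    · refine ⟨L, tendsto_const_nhds.congr' ?_⟩
      filter_upwards [mem_nhdsWithin_of_mem_nhds (Ioi_mem_nhds h)] with r hr
      simp [(mem_Ioi.1 hr).not_gt]

/-- If `ω` stays within `ε` of `L` on `[s,t)`, then `(s, ω)` is close in `d_∞` to time `t` and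
the path frozen at the value `L` from `t` on. -/
theorem dInfty_ite_lt_le {E : Type*} [NormedAddCommGroup E] {T s t ε : ℝ} {ω : ℝ → E} {L : E}
    (hst : s < t) (h : ∀ r ∈ Set.Ico s t, ‖ω r - L‖ ≤ ε) :
    dInfty T (t, fun r => if r < t then ω r else L) (s, ω) ≤ (t - s) + 2 * ε := by
  have hs := h s ⟨le_rfl, hst⟩
  have hε : 0 ≤ ε := (norm_nonneg _).trans hs
  unfold dInfty
  refine add_le_add (abs_of_pos (sub_pos.2 hst)).le (Real.iSup_le (fun r => ?_) (by positivity))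
  obtain ⟨r, -⟩ := r
  dsimp only
  rcases lt_or_ge r t with hr | hr
  · rw [min_eq_left hr.le, if_pos hr]
    rcases lt_or_ge r s with hrs | hrs
    · simp [min_eq_left hrs.le, hε]
    · rw [min_eq_right hrs]
      have := norm_sub_le_norm_sub_add_norm_sub (ω r) L (ω s)
      rw [norm_sub_rev L] at this
      linarith [h r ⟨hrs, hr⟩]
  · rw [min_eq_right hr, if_neg (lt_irrefl t), min_eq_right (hst.le.trans hr), norm_sub_rev]
    linarith

/-- A `d_∞`-continuous functional `u : Λ̄ → ℝ` is (i) non-anticipating,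
`u(t,ω) = u(t,ω_{·∧t})`, and (ii) for every càdlàg `ω` and `t ∈ (0,T]`, the left limit
`lim_{s↑t} u(s,ω)` exists and equals `u(t, ω_{·∧t−})`, where `ω_{·∧t−}` equals `ω` on `[0,t)`
and is constantly equal to the left limit `ω_{t−}` on `[t,T]`. -/
theorem stmt9 (T : ℝ) (hT : 0 < T) (d : ℕ)
    (u : ℝ → (ℝ → EuclideanSpace ℝ (Fin d)) → ℝ) (hu : DCont T u) :
    (∀ t ∈ Set.Icc (0:ℝ) T, ∀ ω : ℝ → EuclideanSpace ℝ (Fin d), Cadlag T ω →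
      u t ω = u t (fun s => ω (min s t))) ∧
    (∀ ω : ℝ → EuclideanSpace ℝ (Fin d), Cadlag T ω → ∀ t ∈ Set.Ioc (0:ℝ) T,
      ∀ L, Filter.Tendsto ω (nhdsWithin t (Set.Iio t)) (nhds L) →
        Filter.Tendsto (fun s => u s ω) (nhdsWithin t (Set.Iio t))
          (nhds (u t (fun s => if s < t then ω s else L)))) := by
  refine ⟨fun t ht ω hω => ?_, fun ω hω t ht L hL => ?_⟩
  · refine eq_of_forall_dist_le fun ε hε => ?_
    obtain ⟨δ, hδ, h⟩ := hu t ht ω hω ε hε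
    exact (h t ht _ (hω.comp_min t) (by simpa [dInfty] using hδ)).le
  · rw [Metric.tendsto_nhds]
    intro ε hε
    obtain ⟨δ, hδ, h⟩ := hu t ⟨ht.1.le, ht.2⟩ _ (hω.ite_lt t L) ε hε
    obtain ⟨a, hat, ha⟩ := (mem_nhdsLT_iff_exists_Ioo_subset).1
      (hL (Metric.ball_mem_nhds L (show 0 < δ / 4 by positivity)))
    have hm : max (max a 0) (t - δ / 2) < t :=
      max_lt (max_lt hat ht.1) (by linarith)
    filter_upwards [Ioo_mem_nhdsLT hm] with s hs
    obtain ⟨⟨has, h0s⟩, hδs⟩ := (max_lt_iff.1 hs.1).imp_left max_lt_iff.1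
    rw [dist_comm, Real.dist_eq]
    refine h s ⟨h0s.le, hs.2.le.trans ht.2⟩ ω hω ?_
    refine (dInfty_ite_lt_le (ε := δ / 4) hs.2 fun r hr => ?_).trans_lt (by linarith)
    exact (mem_ball_iff_norm.1 (ha ⟨has.trans_le hr.1, hr.2⟩)).le
end
end
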